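/- Let G₁ and G₂ be nontrivial finitely generated groups with finite generating sets S₁ and S₂, and for i = 1,2 let φᵢ : Gᵢ → Hᵢ be a surjective homomorphism onto a nontrivial group Hᵢ. Then p_c(G₁*G₂) ≤ p_c(H₁*H₂), where p_c(G₁*G₂) is the critical probability of the Cayley graph of G₁*G₂ with respect to S₁ ⊔ S₂ and p_c(H₁*H₂) is the critical probability of the Cayley graph of H₁*H₂ with respect to φ₁(S₁) ⊔ φ₂(S₂). -/

import Mathlib

open MeasureTheory ENNReal

namespace Perc

/-- Percolation configurations on the edge set `E`: each edge is `true` (open) or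
`false` (closed). -/
abbrev Config (E : Type*) := E → Bool

/-- `μ` is the Bernoulli product measure `P_p` with parameter `p` on `{0,1}^E`: the measure
of every finite cylinder event is the corresponding product.  (This determines `μ` uniquely
on the product σ-algebra, since cylinders form a π-system generating it.) -/
def IsBernoulli {E : Type*} (p : ℝ) (μ : Measure (Config E)) : Prop :=
  ∀ (F : Finset E) (σ : E → Bool),
    μ {ω | ∀ e ∈ F, ω e = σ e} =
      ∏ e ∈ F, ENNReal.ofReal (if σ e then p else 1 - p)

variable {G ι : Type*} [Group G]

/-- In the Cayley graph of `G` with edge set `G × ι`, where the edge `(a, i)` joins `a` and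
`a * f i` (the function `f : ι → G` lists the generators, with multiplicity), this says that
vertices `a` and `b` are joined by some open edge of the configuration `ω`. -/
def Step (f : ι → G) (ω : Config (G × ι)) (a b : G) : Prop :=
  ∃ i : ι, (ω (a, i) = true ∧ b = a * f i) ∨ (ω (b, i) = true ∧ a = b * f i)

/-- `x` and `y` are connected by a path of open edges (`x ↔ y`). -/
def Conn (f : ι → G) (ω : Config (G × ι)) (x y : G) : Prop :=
  Relation.ReflTransGen (Step f ω) x y

/-- The open cluster `C` of the identity. -/
def cluster (f : ι → G) (ω : Config (G × ι)) : Set G :=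
  {x | Conn f ω 1 x}

/-- The percolation function `θ`: the probability that the cluster of the identity is
infinite. -/
noncomputable def theta (f : ι → G) (μ : Measure (Config (G × ι))) : ℝ :=
  (μ {ω | (cluster f ω).Infinite}).toReal

/-- The expected cluster size `χ = E(|C|) ∈ [0,∞]` (where `|C| ∈ ℕ∞` is coerced
to `ℝ≥0∞`). -/
noncomputable def chi (f : ι → G) (μ : Measure (Config (G × ι))) : ℝ≥0∞ :=
  ∫⁻ ω, ((cluster f ω).encard : ℝ≥0∞) ∂μ

/-- The critical probability `p_c = inf {p ∈ [0,1] | θ(p) > 0}`, with the convention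
`p_c = 1` if `θ` vanishes on `[0,1]`; here `μ p` is the percolation measure at
parameter `p`. -/
noncomputable def pc (f : ι → G) (μ : ℝ → Measure (Config (G × ι))) : ℝ :=
  sInf ({p | p ∈ Set.Icc (0 : ℝ) 1 ∧ 0 < theta f (μ p)} ∪ {1})

/-- The word metric on `G` with respect to the generators `f i`: the length of a shortest
word in the generators and their inverses taking `x` to `y`.  (When the generators generate
`G`, this is the graph distance in the Cayley graph.) -/
noncomputable def wdist (f : ι → G) (x y : G) : ℕ :=
  sInf {n : ℕ | ∃ l : List G, l.length = n ∧
    (∀ g ∈ l, (∃ i, f i = g) ∨ (∃ i, (f i)⁻¹ = g)) ∧ x * l.prod = y}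

/-- Schonmann's critical point
`p_exp = sup {p ∈ [0,1] | ∃ c > 0, γ > 0, ∀ x y, P_p(x ↔ y) ≤ c·exp(-γ·dist(x,y))}`. -/
noncomputable def pexp (f : ι → G) (μ : ℝ → Measure (Config (G × ι))) : ℝ :=
  sSup {p | p ∈ Set.Icc (0 : ℝ) 1 ∧ ∃ c > 0, ∃ γ > 0, ∀ x y : G,
    (μ p {ω | Conn f ω x y}).toReal ≤ c * Real.exp (-γ * (wdist f x y : ℝ))}

/-- The walk-through function `g(p,t) = 1 - ∑_{n≥1} (1-t)^{n-1} P_p(|C| = n)` of a Cayley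
graph; here `μ` is the percolation measure at parameter `p`. -/
noncomputable def wt (f : ι → G) (μ : Measure (Config (G × ι))) (t : ℝ) : ℝ :=
  1 - ∑' n : ℕ, (1 - t) ^ n * (μ {ω | (cluster f ω).encard = ((n + 1 : ℕ) : ℕ∞)}).toReal

/-- The ball of radius `j`: all products of at most `j` elements of `S ∪ S⁻¹`. -/
def ball (S : Set G) (j : ℕ) : Set G :=
  {g | ∃ l : List G, l.length ≤ j ∧ (∀ x ∈ l, x ∈ S ∨ x⁻¹ ∈ S) ∧ l.prod = g}

/-- The Cheeger constant `h = inf_K |∂K| / |K|`, the infimum over nonempty finite vertex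
sets `K` of the number of edges `(a, i)` (joining `a` and `a * f i`) with exactly one
endpoint in `K`, divided by `|K|`. -/
noncomputable def cheeger (f : ι → G) : ℝ :=
  ⨅ K : {K : Finset G // K.Nonempty},
    (Nat.card {e : G × ι // Xor' (e.1 ∈ K.1) (e.1 * f e.2 ∈ K.1)} : ℝ) / (K.1.card : ℝ)

/-- The open cluster of the identity in the subgraph induced on the vertex set `V`: only
open edges with both endpoints in `V` may be used. -/
def clusterIn (f : ι → G) (V : Set G) (ω : Config (G × ι)) : Set G :=
  {x | Relation.ReflTransGen (fun a b => Step f ω a b ∧ a ∈ V ∧ b ∈ V) 1 x}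

/-- The generators of `G` given by a generating set `S` (one edge orbit per element
of `S`). -/
def setGens (S : Set G) : S → G := Subtype.val

/-- The generators of the free product `G₁ * G₂` given by the disjoint union `S₁ ⊔ S₂` of
generating sets, embedded via the canonical monomorphisms. -/
def coprodGens {G₁ G₂ : Type*} [Group G₁] [Group G₂] (S₁ : Set G₁) (S₂ : Set G₂) :
    S₁ ⊕ S₂ → Monoid.Coprod G₁ G₂ :=
  Sum.elim (fun s => Monoid.Coprod.inl (s : G₁)) (fun s => Monoid.Coprod.inr (s : G₂))

/-- The generators of the free product `G₁ * ⋯ * G_n` given by the disjoint union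
`S₁ ⊔ ⋯ ⊔ S_n` of generating sets, embedded via the canonical monomorphisms. -/
def coprodIGens {n : ℕ} {G : Fin n → Type*} [∀ i, Group (G i)] (S : ∀ i, Set (G i)) :
    (Σ i, S i) → Monoid.CoprodI G :=
  fun x => Monoid.CoprodI.of (x.2 : G x.1)

/-- The image of a list of syllables in the free product `G₁ * G₂`. -/
def sylProd {G₁ G₂ : Type*} [Group G₁] [Group G₂] (l : List (G₁ ⊕ G₂)) :
    Monoid.Coprod G₁ G₂ :=
  (l.map (Sum.elim (fun g => Monoid.Coprod.inl g) (fun h => Monoid.Coprod.inr h))).prod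

/-- The set `P₁` of nontrivial elements of `G₁ * G₂` whose normal form begins with a
nontrivial syllable of `G₁`: elements represented by a nonempty alternating product of
nontrivial syllables, the first syllable lying in `G₁`.  (Such a representation is the
normal form, which is unique.) -/
def beginsLeft {G₁ G₂ : Type*} [Group G₁] [Group G₂] (x : Monoid.Coprod G₁ G₂) : Prop :=
  ∃ l : List (G₁ ⊕ G₂), l ≠ [] ∧ (∀ a ∈ l, a ≠ Sum.inl 1 ∧ a ≠ Sum.inr 1) ∧
    l.Chain' (fun a b => a.isLeft ≠ b.isLeft) ∧
    (∃ g : G₁, l.head? = some (Sum.inl g)) ∧ sylProd l = x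

/-- The set `P₂` of nontrivial elements of `G₁ * G₂` whose normal form begins with a
nontrivial syllable of `G₂`. -/
def beginsRight {G₁ G₂ : Type*} [Group G₁] [Group G₂] (x : Monoid.Coprod G₁ G₂) : Prop :=
  ∃ l : List (G₁ ⊕ G₂), l ≠ [] ∧ (∀ a ∈ l, a ≠ Sum.inl 1 ∧ a ≠ Sum.inr 1) ∧
    l.Chain' (fun a b => a.isLeft ≠ b.isLeft) ∧
    (∃ h : G₂, l.head? = some (Sum.inr h)) ∧ sylProd l = x

end Perc

namespace Perc

section BernoulliMeasure

variable {E : Type*} {p : ℝ} {μ : Measure (Config E)}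

/-- The cylinder event that `ω` agrees with `σ` on the finite edge set `F`. -/
def cylinder (F : Finset E) (σ : Config E) : Set (Config E) :=
  {ω | ∀ e ∈ F, ω e = σ e}

lemma measurableSet_coord (e : E) (b : Bool) : MeasurableSet {ω : Config E | ω e = b} :=
  (measurable_pi_apply e : Measurable fun ω : Config E => ω e) (measurableSet_singleton b)

/-- The nonempty cylinders, together with the empty set. -/
def cylinders (E : Type*) : Set (Set (Config E)) :=
  {S | S = ∅ ∨ ∃ F σ, S = cylinder F σ}

lemma isPiSystem_cylinders : IsPiSystem (cylinders E) := by
  classical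
  rintro S (rfl | ⟨F, σ, rfl⟩) T (rfl | ⟨F', σ', rfl⟩) ⟨ω, hS, hT⟩
  · exact hS.elim
  · exact hS.elim
  · exact hT.elim
  · refine Or.inr ⟨F ∪ F', ω, ?_⟩
    ext η
    simp only [cylinder, Set.mem_inter_iff, Set.mem_ofPred_eq, Finset.mem_union] at *
    constructor
    · rintro ⟨h, h'⟩ e (he | he)
      · rw [h e he, hS e he]
      · rw [h' e he, hT e he]
    · intro h
      exact ⟨fun e he => by rw [h e (Or.inl he), hS e he],
        fun e he => by rw [h e (Or.inr he), hT e he]⟩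

lemma generateFrom_cylinders :
    (inferInstance : MeasurableSpace (Config E)) =
      MeasurableSpace.generateFrom (cylinders E) := by
  apply le_antisymm
  · refine iSup_le fun e => ?_
    rw [← measurable_iff_comap_le]
    refine @measurable_to_countable' _ _ _ _ (_) _ fun b => ?_
    refine MeasurableSpace.measurableSet_generateFrom (Or.inr ⟨{e}, fun _ => b, ?_⟩)
    ext ω
    simp [cylinder]
  · refine MeasurableSpace.generateFrom_le ?_
    rintro S (rfl | ⟨F, σ, rfl⟩)
    · exact MeasurableSet.empty
    · have : cylinder F σ = ⋂ e ∈ F, {ω : Config E | ω e = σ e} := by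
        ext ω; simp [cylinder]
      rw [this]
      exact Finset.measurableSet_biInter F fun e _ => measurableSet_coord e (σ e)

lemma IsBernoulli.measure_univ (h : IsBernoulli p μ) : μ Set.univ = 1 := by
  simpa using h ∅ fun _ => true

lemma IsBernoulli.isProbabilityMeasure (h : IsBernoulli p μ) : IsProbabilityMeasure μ :=
  ⟨h.measure_univ⟩

/-- An event that does not depend on the state of the edge `e` is independent of it. -/
lemma IsBernoulli.measure_inter_coord [DecidableEq E] (h : IsBernoulli p μ) (e : E) (b : Bool)
    {B : Set (Config E)} (hB : MeasurableSet B)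
    (hinv : ∀ ω, Function.update ω e false ∈ B ↔ ω ∈ B) :
    μ (B ∩ {ω | ω e = b}) = ENNReal.ofReal (if b then p else 1 - p) * μ B := by
  have := h.isProbabilityMeasure
  set c := ENNReal.ofReal (if b then p else 1 - p) with hc
  set u : Config E → Config E := fun ω => Function.update ω e false with hu
  have hum : Measurable u := by
    refine measurable_pi_lambda _ fun x => ?_
    by_cases hx : x = e
    · subst hx; simp [hu]
    · simpa [hu, hx] using measurable_pi_apply x
  have hcyl : ∀ (F : Finset E) (σ : Config E),
      μ (u ⁻¹' cylinder F σ ∩ {ω | ω e = b}) = c * μ (u ⁻¹' cylinder F σ) := by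
    intro F σ
    by_cases hF : e ∈ F ∧ σ e = true
    · have : u ⁻¹' cylinder F σ = ∅ := by
        ext ω
        simp only [Set.mem_preimage, Set.mem_empty_iff_false, iff_false]
        intro hω
        have := hω e hF.1
        simp [hu, hF.2] at this
      simp [this]
    · have h1 : u ⁻¹' cylinder F σ = cylinder (F.erase e) σ := by
        ext ω
        simp only [cylinder, hu, Set.mem_preimage, Set.mem_ofPred_eq, Finset.mem_erase]
        constructor
        · rintro hω x ⟨hx, hxF⟩
          simpa [hx] using hω x hxF
        · intro hω x hxF
          by_cases hx : x = e
          · subst hx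
            simp_all
          · simpa [hx] using hω x ⟨hx, hxF⟩
      have h2 : cylinder (F.erase e) σ ∩ {ω | ω e = b} =
          cylinder (insert e (F.erase e)) (Function.update σ e b) := by
        ext ω
        simp only [cylinder, Set.mem_inter_iff, Set.mem_ofPred_eq, Finset.forall_mem_insert,
          Function.update_self]
        rw [and_comm]
        refine and_congr_right fun _ => forall₂_congr fun x hx => ?_
        rw [Function.update_of_ne (Finset.ne_of_mem_erase hx)]
      rw [h1, h2]
      unfold cylinder
      rw [h, h, Finset.prod_insert (Finset.notMem_erase e F), Function.update_self]
      congr 1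
      refine Finset.prod_congr rfl fun x hx => ?_
      rw [Function.update_of_ne (Finset.ne_of_mem_erase hx)]
  have hres : ∀ T, MeasurableSet T →
      (μ.restrict {ω | ω e = b}).map u T = μ (u ⁻¹' T ∩ {ω | ω e = b}) := fun T hT => by
    rw [Measure.map_apply hum hT, Measure.restrict_apply (hum hT)]
  have hmeas : ∀ S ∈ cylinders E, MeasurableSet S := fun S hS => by
    have := MeasurableSpace.measurableSet_generateFrom hS
    rwa [← generateFrom_cylinders] at this
  have key : (μ.restrict {ω | ω e = b}).map u = c • μ.map u := by
    have : IsFiniteMeasure ((μ.restrict {ω | ω e = b}).map u) :=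
      Measure.isFiniteMeasure_map _ _
    refine ext_of_generate_finite _ generateFrom_cylinders isPiSystem_cylinders ?_ ?_
    · intro S hS
      rw [hres S (hmeas S hS), Measure.smul_apply, Measure.map_apply hum (hmeas S hS),
        smul_eq_mul]
      rcases hS with rfl | ⟨F, σ, rfl⟩
      · simp
      · exact hcyl F σ
    · rw [hres _ MeasurableSet.univ, Measure.smul_apply, Measure.map_apply hum MeasurableSet.univ,
        smul_eq_mul]
      simpa [cylinder] using hcyl ∅ fun _ => true
  have hBu : u ⁻¹' B = B := Set.ext hinv
  have := congrArg (fun ν => ν B) key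
  simpa [hres B hB, Measure.map_apply hum hB, hBu] using this

lemma IsBernoulli.measure_eq_add [DecidableEq E] (h : IsBernoulli p μ) (e : E)
    {B B₁ B₀ : Set (Config E)} (hB₁ : MeasurableSet B₁) (hB₀ : MeasurableSet B₀)
    (hinv₁ : ∀ ω, Function.update ω e false ∈ B₁ ↔ ω ∈ B₁)
    (hinv₀ : ∀ ω, Function.update ω e false ∈ B₀ ↔ ω ∈ B₀)
    (hopen : ∀ ω : Config E, ω e = true → (ω ∈ B ↔ ω ∈ B₁))
    (hclosed : ∀ ω : Config E, ω e = false → (ω ∈ B ↔ ω ∈ B₀)) :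
    μ B = ENNReal.ofReal p * μ B₁ + ENNReal.ofReal (1 - p) * μ B₀ := by
  have h1 := h.measure_inter_coord e true hB₁ hinv₁
  have h0 := h.measure_inter_coord e false hB₀ hinv₀
  simp only [if_true, Bool.false_eq_true, if_false] at h1 h0
  rw [← measure_inter_add_sdiff B (measurableSet_coord e true), ← h1, ← h0]
  congr 2
  · ext ω
    exact and_congr_left fun hω => hopen ω hω
  · ext ω
    simp only [Set.mem_sdiff, Set.mem_inter_iff, Set.mem_ofPred_eq, Bool.not_eq_true]
    exact and_congr_left fun hω => hclosed ω hω

end BernoulliMeasure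

section Mask

variable {E : Type*}

open Classical in
/-- The configuration `ω` with all edges outside `A` closed. -/
noncomputable def mask (A : Set E) (ω : Config E) : Config E :=
  fun e => if e ∈ A then ω e else false

lemma mask_eq_true {A : Set E} {ω : Config E} {e : E} :
    mask A ω e = true ↔ e ∈ A ∧ ω e = true := by
  by_cases h : e ∈ A <;> simp [mask, h]

lemma mask_univ (ω : Config E) : mask Set.univ ω = ω := by
  ext e; simp [mask]

lemma measurable_mask (A : Set E) : Measurable (mask A) := by
  refine measurable_pi_lambda _ fun e => ?_
  by_cases h : e ∈ A
  · simpa [mask, h] using measurable_pi_apply e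
  · simp [mask, h]

lemma mask_update [DecidableEq E] {A : Set E} {e : E} (he : e ∉ A) (ω : Config E) (b : Bool) :
    mask A (Function.update ω e b) = mask A ω := by
  ext x
  by_cases hx : x = e
  · subst hx; simp [mask, he]
  · simp [mask, hx]

end Mask

section Reach

variable {G ι : Type*} [Group G] {f : ι → G}

/-- The set of vertices joined by open paths to the vertex set `W`. -/
def reach (f : ι → G) (ω : Config (G × ι)) (W : Set G) : Set G :=
  {x | ∃ w ∈ W, Conn f ω w x}

lemma cluster_eq_reach (ω : Config (G × ι)) : cluster f ω = reach f ω {1} := by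
  simp [cluster, reach]

lemma subset_reach (ω : Config (G × ι)) (W : Set G) : W ⊆ reach f ω W :=
  fun w hw => ⟨w, hw, Relation.ReflTransGen.refl⟩

lemma Step.mono {ω η : Config (G × ι)} (h : ∀ e, ω e = true → η e = true) {a b : G}
    (hab : Step f ω a b) : Step f η a b := by
  obtain ⟨i, hi⟩ := hab
  exact ⟨i, hi.imp (And.imp_left (h _)) (And.imp_left (h _))⟩

lemma Conn.mono {ω η : Config (G × ι)} (h : ∀ e, ω e = true → η e = true) {a b : G}
    (hab : Conn f ω a b) : Conn f η a b :=
  Relation.ReflTransGen.mono (fun _ _ => Step.mono h) _ _ hab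

lemma reach_mono {ω η : Config (G × ι)} (h : ∀ e, ω e = true → η e = true) (W : Set G) :
    reach f ω W ⊆ reach f η W :=
  fun _ ⟨w, hw, hx⟩ => ⟨w, hw, hx.mono h⟩

lemma reach_mask_mono {A B : Set (G × ι)} (h : A ⊆ B) (ω : Config (G × ι)) (W : Set G) :
    reach f (mask A ω) W ⊆ reach f (mask B ω) W :=
  reach_mono (fun e he => by
    rw [mask_eq_true] at he ⊢
    exact ⟨h he.1, he.2⟩) W

lemma reach_subset_of_closed {ω : Config (G × ι)} {W T : Set G} (hWT : W ⊆ T)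
    (hT : ∀ a b, a ∈ T → Step f ω a b → b ∈ T) : reach f ω W ⊆ T := by
  rintro x ⟨w, hw, hx⟩
  induction hx with
  | refl => exact hWT hw
  | tail _ hab ih => exact hT _ _ ih hab

lemma reach_closed {ω : Config (G × ι)} {W : Set G} {a b : G} (ha : a ∈ reach f ω W)
    (hab : Step f ω a b) : b ∈ reach f ω W := by
  obtain ⟨w, hw, hwa⟩ := ha
  exact ⟨w, hw, hwa.tail hab⟩

lemma reach_mask_of_isolated {A : Set (G × ι)} {V : Set G}
    (hA : ∀ e ∈ A, e.1 ∉ V ∧ e.1 * f e.2 ∉ V) (ω : Config (G × ι)) :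
    reach f (mask A ω) V ⊆ V := by
  refine reach_subset_of_closed subset_rfl ?_
  rintro a b ha ⟨i, ⟨h, hb⟩ | ⟨h, hb⟩⟩
  · exact absurd ha (hA _ (mask_eq_true.1 h).1).1
  · exact absurd (hb ▸ ha) (hA _ (mask_eq_true.1 h).1).2

/-- Revealing that the edge `e`, one of whose endpoints lies in `W`, is open. -/
lemma reach_mask_of_open {A : Set (G × ι)} {ω : Config (G × ι)} {e : G × ι} (heA : e ∈ A)
    (he : ω e = true) {W : Set G} {w u : G} (hw : w ∈ W)
    (hwu : (w = e.1 ∧ u = e.1 * f e.2) ∨ (u = e.1 ∧ w = e.1 * f e.2)) :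
    reach f (mask A ω) W = reach f (mask (A \ {e}) ω) (insert u W) := by
  have hstep : Step f (mask A ω) w u := by
    refine ⟨e.2, ?_⟩
    rcases hwu with ⟨rfl, hu⟩ | ⟨rfl, hw'⟩
    · exact Or.inl ⟨mask_eq_true.2 ⟨heA, he⟩, hu⟩
    · exact Or.inr ⟨mask_eq_true.2 ⟨heA, he⟩, hw'⟩
  apply subset_antisymm
  · have hend : ∀ x, x = e.1 ∨ x = e.1 * f e.2 →
        x ∈ reach f (mask (A \ {e}) ω) (insert u W) := by
      intro x hx
      apply subset_reach
      rcases hwu with ⟨h1, h2⟩ | ⟨h1, h2⟩ <;> rcases hx with hx | hx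
      · exact Or.inr (by rwa [hx, ← h1])
      · exact Or.inl (hx.trans h2.symm)
      · exact Or.inl (hx.trans h1.symm)
      · exact Or.inr (by rwa [hx, ← h2])
    refine reach_subset_of_closed ((Set.subset_insert u W).trans (subset_reach _ _)) ?_
    rintro a b ha ⟨i, ⟨h, hb⟩ | ⟨h, hb⟩⟩
    · by_cases hai : (a, i) = e
      · subst hai
        exact hend b (Or.inr hb)
      · refine reach_closed ha ⟨i, Or.inl ⟨?_, hb⟩⟩
        rw [mask_eq_true] at h ⊢
        exact ⟨⟨h.1, hai⟩, h.2⟩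
    · by_cases hai : (b, i) = e
      · subst hai
        exact hend b (Or.inl rfl)
      · refine reach_closed ha ⟨i, Or.inr ⟨?_, hb⟩⟩
        rw [mask_eq_true] at h ⊢
        exact ⟨⟨h.1, hai⟩, h.2⟩
  · refine (reach_mask_mono Set.sdiff_subset ω _).trans ?_
    refine reach_subset_of_closed ?_ fun a b => reach_closed
    exact Set.insert_subset (reach_closed (subset_reach _ _ hw) hstep) (subset_reach _ _)

lemma mask_of_closed {E : Type*} {A : Set E} {ω : Config E} {e : E} (he : ω e = false) :
    mask A ω = mask (A \ {e}) ω := by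
  ext x
  by_cases hx : x = e
  · subst hx; simp [mask, he]
  · by_cases hxA : x ∈ A <;> simp [mask, hx, hxA]

lemma measurableSet_step [Countable ι] (a b : G) :
    MeasurableSet {ω : Config (G × ι) | Step f ω a b} := by
  have : {ω : Config (G × ι) | Step f ω a b} =
      ⋃ i, ({ω : Config (G × ι) | ω (a, i) = true} ∩ {_ω | b = a * f i}) ∪
        ({ω : Config (G × ι) | ω (b, i) = true} ∩ {_ω | a = b * f i}) := by
    ext ω; simp [Step]
  rw [this]
  exact MeasurableSet.iUnion fun i =>
    ((measurableSet_coord _ _).inter (MeasurableSet.const _)).union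
      ((measurableSet_coord _ _).inter (MeasurableSet.const _))

lemma measurableSet_conn [Countable ι] [Countable G] (a b : G) :
    MeasurableSet {ω : Config (G × ι) | Conn f ω a b} := by
  have hchain : ∀ (l : List G) (a : G),
      MeasurableSet {ω : Config (G × ι) | (a :: l).IsChain (Step f ω)} := by
    intro l
    induction l with
    | nil => intro a; simp
    | cons c l ih =>
      intro a
      simp only [List.isChain_cons_cons]
      exact (measurableSet_step a c).inter (ih c)
  have : {ω : Config (G × ι) | Conn f ω a b} =
      ⋃ l : List G, {ω : Config (G × ι) | (a :: l).IsChain (Step f ω)} ∩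
        {_ω | (a :: l).getLast (List.cons_ne_nil _ _) = b} := by
    ext ω
    simp only [Set.mem_ofPred_eq, Set.mem_iUnion, Set.mem_inter_iff]
    constructor
    · exact List.exists_isChain_cons_of_relationReflTransGen
    · rintro ⟨l, h1, h2⟩
      exact List.relationReflTransGen_of_exists_isChain_cons l h1 h2
  rw [this]
  exact MeasurableSet.iUnion fun l => (hchain l a).inter (MeasurableSet.const _)

/-- The event that at least `n` vertices are joined to `W` by open paths inside `A`. -/
def largeReach (f : ι → G) (n : ℕ) (A : Set (G × ι)) (W : Set G) : Set (Config (G × ι)) :=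
  {ω | (n : ℕ∞) ≤ (reach f (mask A ω) W).encard}

lemma natCast_le_encard_iff {α : Type*} {n : ℕ} {s : Set α} :
    (n : ℕ∞) ≤ s.encard ↔ ∃ t : Finset α, ↑t ⊆ s ∧ t.card = n := by
  constructor
  · intro h
    obtain ⟨t, hts, ht⟩ := Set.exists_subset_encard_eq h
    have htf : t.Finite := Set.finite_of_encard_eq_coe ht
    refine ⟨htf.toFinset, by simpa using hts, ?_⟩
    rw [htf.encard_eq_coe_toFinset_card] at ht
    exact_mod_cast ht
  · rintro ⟨t, hts, rfl⟩
    rw [← Set.encard_coe_eq_coe_finsetCard]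
    exact Set.encard_le_encard hts

lemma measurableSet_largeReach [Countable ι] [Countable G] (n : ℕ) (A : Set (G × ι))
    (W : Set G) : MeasurableSet (largeReach f n A W) := by
  have : largeReach f n A W = mask A ⁻¹' ⋃ t : Finset G,
      {_ω | t.card = n} ∩ ⋂ x ∈ t, ⋃ w ∈ W, {ω : Config (G × ι) | Conn f ω w x} := by
    ext ω
    simp only [largeReach, natCast_le_encard_iff, Set.mem_ofPred_eq, Set.mem_preimage,
      Set.mem_iUnion, Set.mem_inter_iff, Set.mem_iInter, exists_prop]
    exact exists_congr fun t => and_comm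
  rw [this]
  refine measurable_mask A (MeasurableSet.iUnion fun t => (MeasurableSet.const _).inter
    (Finset.measurableSet_biInter t fun x _ =>
      MeasurableSet.biUnion W.to_countable fun w _ => measurableSet_conn w x))

lemma largeReach_mono {n : ℕ} {A B : Set (G × ι)} (h : A ⊆ B) (W : Set G) :
    largeReach f n A W ⊆ largeReach f n B W :=
  fun ω hω => le_trans hω (Set.encard_le_encard (reach_mask_mono h ω W))

lemma update_mem_largeReach [DecidableEq (G × ι)] {n : ℕ} {A : Set (G × ι)} {W : Set G}
    {e : G × ι} (he : e ∉ A) (ω : Config (G × ι)) :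
    Function.update ω e false ∈ largeReach f n A W ↔ ω ∈ largeReach f n A W := by
  simp only [largeReach, Set.mem_ofPred_eq, mask_update he]

/-- One step of the exploration process: conditioning on the state of an edge incident
to `W`. -/
lemma IsBernoulli.largeReach_eq_add [Countable ι] [Countable G] {p : ℝ}
    {μ : Measure (Config (G × ι))} (h : IsBernoulli p μ) (n : ℕ) {A : Set (G × ι)}
    {e : G × ι} (heA : e ∈ A) {W : Set G} {w u : G} (hw : w ∈ W)
    (hwu : (w = e.1 ∧ u = e.1 * f e.2) ∨ (u = e.1 ∧ w = e.1 * f e.2)) :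
    μ (largeReach f n A W) = ENNReal.ofReal p * μ (largeReach f n (A \ {e}) (insert u W)) +
      ENNReal.ofReal (1 - p) * μ (largeReach f n (A \ {e}) W) := by
  classical
  refine h.measure_eq_add e (measurableSet_largeReach _ _ _) (measurableSet_largeReach _ _ _)
    (update_mem_largeReach (by simp)) (update_mem_largeReach (by simp)) ?_ ?_
  · intro ω hω
    simp only [largeReach, Set.mem_ofPred_eq, reach_mask_of_open heA hω hw hwu]
  · intro ω hω
    simp only [largeReach, Set.mem_ofPred_eq]
    rw [mask_of_closed hω]

lemma Conn.exists_finset {ω : Config (G × ι)} {a b : G} (h : Conn f ω a b) :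
    ∃ F : Finset (G × ι), Conn f (mask (F : Set (G × ι)) ω) a b := by
  classical
  induction h with
  | refl => exact ⟨∅, Relation.ReflTransGen.refl⟩
  | @tail c d _ hcd ih =>
    obtain ⟨F, hF⟩ := ih
    obtain ⟨i, hi⟩ := hcd
    refine ⟨insert (c, i) (insert (d, i) F), Relation.ReflTransGen.tail (b := c) ?_ ⟨i, ?_⟩⟩
    · refine hF.mono fun e he => ?_
      rw [mask_eq_true] at he ⊢
      exact ⟨by simp [Finset.mem_coe.1 he.1], he.2⟩
    · refine hi.imp (And.imp_left fun h => ?_) (And.imp_left fun h => ?_) <;>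
        simp [mask_eq_true, h]

lemma largeReach_univ_eq_iUnion (n : ℕ) (W : Set G) :
    largeReach f n Set.univ W = ⋃ F : Finset (G × ι), largeReach f n (F : Set (G × ι)) W := by
  classical
  apply subset_antisymm
  · intro ω hω
    obtain ⟨t, ht, htn⟩ := natCast_le_encard_iff.1 hω
    have : ∀ x ∈ t, ∃ F : Finset (G × ι), x ∈ reach f (mask (F : Set (G × ι)) ω) W := by
      intro x hx
      obtain ⟨w, hw, hwx⟩ := ht hx
      rw [mask_univ] at hwx
      obtain ⟨F, hF⟩ := hwx.exists_finset
      exact ⟨F, w, hw, hF⟩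
    choose! F hF using this
    refine Set.mem_iUnion.2 ⟨t.biUnion F, natCast_le_encard_iff.2 ⟨t, fun x hx => ?_, htn⟩⟩
    exact reach_mask_mono (Finset.coe_subset.2 (Finset.subset_biUnion_of_mem F hx)) ω W (hF x hx)
  · exact Set.iUnion_subset fun F => largeReach_mono (Set.subset_univ _) W

lemma measure_largeReach_univ [Countable ι] [Countable G] (μ : Measure (Config (G × ι)))
    (n : ℕ) (W : Set G) :
    μ (largeReach f n Set.univ W) =
      ⨆ F : Finset (G × ι), μ (largeReach f n (F : Set (G × ι)) W) := by
  rw [largeReach_univ_eq_iUnion]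
  exact Monotone.measure_iUnion fun F F' h => largeReach_mono (Finset.coe_subset.2 h) W

lemma setOf_cluster_infinite :
    {ω | (cluster f ω).Infinite} = ⋂ n : ℕ, largeReach f n Set.univ {1} := by
  ext ω
  simp only [largeReach, mask_univ, cluster_eq_reach, Set.mem_ofPred_eq, Set.mem_iInter,
    ← Set.encard_eq_top_iff, ENat.eq_top_iff_forall_ge]

lemma measure_cluster_infinite [Countable ι] [Countable G] (μ : Measure (Config (G × ι)))
    [IsFiniteMeasure μ] :
    μ {ω | (cluster f ω).Infinite} = ⨅ n : ℕ, μ (largeReach f n Set.univ {1}) := by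
  rw [setOf_cluster_infinite]
  refine Antitone.measure_iInter (fun m n hmn ω hω => ?_)
    (fun n => (measurableSet_largeReach _ _ _).nullMeasurableSet) ⟨0, measure_ne_top _ _⟩
  exact le_trans (Nat.cast_le.2 hmn : (m : ℕ∞) ≤ n) hω

end Reach

section Quotient

variable {G H ι κ : Type*} [Group G] [Group H] {f : ι → G} {g : κ → H}

/-- The edges `(a, r k)` of a Cayley graph of `G` lying over an edge `(φ a, k) ∈ F`. -/
def liftEdges (φ : G →* H) (r : κ → ι) (F : Set (H × κ)) : Set (G × ι) :=
  {e | ∃ k, e.2 = r k ∧ (φ e.1, k) ∈ F}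

lemma liftEdges_diff_subset (φ : G →* H) {r : κ → ι} (hr : Function.Injective r)
    (F : Set (H × κ)) (a : G) (k : κ) :
    liftEdges φ r (F \ {(φ a, k)}) ⊆ liftEdges φ r F \ {(a, r k)} := by
  rintro ⟨b, i⟩ ⟨k', hk', hF, hne⟩
  refine ⟨⟨k', hk', hF⟩, ?_⟩
  rintro ⟨rfl, rfl⟩
  exact hne (by rw [hr hk']; rfl)

lemma measure_largeReach_le_lift [Countable ι] [Countable G] [Countable κ] [Countable H]
    {φ : G →* H} {r : κ → ι} (hr : Function.Injective r) (hφ : ∀ k, φ (f (r k)) = g k)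
    {p : ℝ} {μ : Measure (Config (G × ι))} {ν : Measure (Config (H × κ))}
    (hμ : IsBernoulli p μ) (hν : IsBernoulli p ν) (n : ℕ) (F : Finset (H × κ))
    {V : Set H} {W : Set G} (hVW : V ⊆ φ '' W) :
    ν (largeReach g n (F : Set (H × κ)) V) ≤ μ (largeReach f n (liftEdges φ r F) W) := by
  classical
  induction F using Finset.strongInduction generalizing V W with
  | H F ih =>
    by_cases hinc : ∃ e ∈ F, ∃ v u, v ∈ V ∧
        ((v = e.1 ∧ u = e.1 * g e.2) ∨ (u = e.1 ∧ v = e.1 * g e.2))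
    · obtain ⟨⟨h, k⟩, heF, v, u, hv, hvu⟩ := hinc
      obtain ⟨w, hw, rfl⟩ := hVW hv
      obtain ⟨a, w', ha, hw', hww'⟩ : ∃ a w', φ a = h ∧ φ w' = u ∧
          ((w = a ∧ w' = a * f (r k)) ∨ (w' = a ∧ w = a * f (r k))) := by
        rcases hvu with ⟨h1, h2⟩ | ⟨h1, h2⟩
        · exact ⟨w, w * f (r k), h1, by rw [map_mul, hφ, h1, h2], Or.inl ⟨rfl, rfl⟩⟩
        · have : φ (w * (f (r k))⁻¹) = h := by
            rw [map_mul, map_inv, hφ]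
            exact mul_inv_eq_of_eq_mul h2
          exact ⟨w * (f (r k))⁻¹, w * (f (r k))⁻¹, this, this.trans h1.symm,
            Or.inr ⟨rfl, by simp⟩⟩
      subst ha hw'
      have hlift : (a, r k) ∈ liftEdges φ r (F : Set (H × κ)) := ⟨k, rfl, heF⟩
      rw [hν.largeReach_eq_add n (Finset.mem_coe.2 heF) hv hvu,
        hμ.largeReach_eq_add n hlift hw hww']
      have hstep : ∀ {V' : Set H} {W' : Set G}, V' ⊆ φ '' W' →
          ν (largeReach g n ((F : Set (H × κ)) \ {(φ a, k)}) V') ≤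
            μ (largeReach f n (liftEdges φ r F \ {(a, r k)}) W') := by
        intro V' W' h'
        have := ih _ (Finset.erase_ssubset heF) h'
        rw [Finset.coe_erase] at this
        exact this.trans
          (measure_mono (largeReach_mono (liftEdges_diff_subset φ hr _ a k) W'))
      gcongr
      · refine hstep ?_
        rw [Set.image_insert_eq]
        exact Set.insert_subset_insert hVW
      · exact hstep hVW
    · have hiso : ∀ e ∈ (F : Set (H × κ)), e.1 ∉ V ∧ e.1 * g e.2 ∉ V := fun e he =>
        ⟨fun hV => hinc ⟨e, he, _, _, hV, Or.inl ⟨rfl, rfl⟩⟩,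
          fun hV => hinc ⟨e, he, _, _, hV, Or.inr ⟨rfl, rfl⟩⟩⟩
      have hVW' : V.encard ≤ W.encard :=
        (Set.encard_le_encard hVW).trans (Set.encard_image_le φ W)
      by_cases hn : (n : ℕ∞) ≤ V.encard
      · have : largeReach f n (liftEdges φ r F) W = Set.univ :=
          Set.eq_univ_of_forall fun ω =>
            (hn.trans hVW').trans (Set.encard_le_encard (subset_reach _ W))
        rw [this, hμ.measure_univ, ← hν.measure_univ]
        exact measure_mono (Set.subset_univ _)
      · have : largeReach g n (F : Set (H × κ)) V = ∅ :=
          Set.eq_empty_of_forall_notMem fun ω hω =>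
            hn (le_trans hω (Set.encard_le_encard (reach_mask_of_isolated hiso ω)))
        simp [this]

/-- Passing to a quotient of a Cayley graph does not increase the percolation function. -/
lemma theta_le_theta_of_quotient [Countable ι] [Countable G] [Countable κ] [Countable H]
    {φ : G →* H} {r : κ → ι} (hr : Function.Injective r) (hφ : ∀ k, φ (f (r k)) = g k)
    {p : ℝ} {μ : Measure (Config (G × ι))} {ν : Measure (Config (H × κ))}
    (hμ : IsBernoulli p μ) (hν : IsBernoulli p ν) : theta g ν ≤ theta f μ := by
  have := hμ.isProbabilityMeasure
  have := hν.isProbabilityMeasure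
  refine ENNReal.toReal_mono (measure_ne_top _ _) ?_
  rw [measure_cluster_infinite, measure_cluster_infinite]
  refine iInf_mono fun n => ?_
  rw [measure_largeReach_univ ν]
  refine iSup_le fun F => ?_
  refine (measure_largeReach_le_lift hr hφ hμ hν n F (W := {1}) (by simp)).trans ?_
  exact measure_mono (largeReach_mono (Set.subset_univ _) _)

lemma pc_le_pc_of_quotient [Countable ι] [Countable G] [Countable κ] [Countable H]
    {φ : G →* H} {r : κ → ι} (hr : Function.Injective r) (hφ : ∀ k, φ (f (r k)) = g k)
    {μ : ℝ → Measure (Config (G × ι))} {ν : ℝ → Measure (Config (H × κ))}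
    (hμ : ∀ p ∈ Set.Icc (0 : ℝ) 1, IsBernoulli p (μ p))
    (hν : ∀ p ∈ Set.Icc (0 : ℝ) 1, IsBernoulli p (ν p)) : pc f μ ≤ pc g ν := by
  refine csInf_le_csInf ⟨0, ?_⟩ ⟨1, Or.inr rfl⟩ (Set.union_subset_union_left _ ?_)
  · rintro p (hp | rfl)
    · exact hp.1.1
    · exact zero_le_one
  · rintro p ⟨hp, hpos⟩
    exact ⟨hp, hpos.trans_le (theta_le_theta_of_quotient hr hφ (hμ p hp) (hν p hp))⟩

end Quotient

lemma countable_of_closure_eq_top {G : Type*} [Group G] {S : Set G} (hS : S.Countable)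
    (h : Subgroup.closure S = ⊤) : Countable G := by
  have := hS.to_subtype
  have : Countable (FreeGroup S) := Quot.mk_surjective.countable
  have hsurj : Function.Surjective (FreeGroup.lift (Subtype.val : S → G)) := by
    rw [← MonoidHom.range_eq_top, FreeGroup.range_lift_eq_closure, Subtype.range_coe, h]
  exact hsurj.countable

lemma countable_coprod {G₁ G₂ : Type*} [Group G₁] [Group G₂] [Countable G₁] [Countable G₂] :
    Countable (Monoid.Coprod G₁ G₂) :=
  have : Countable (FreeMonoid (G₁ ⊕ G₂)) := inferInstanceAs (Countable (List (G₁ ⊕ G₂)))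
  Monoid.Coprod.mk_surjective.countable

end Perc

open Perc

/-- For surjective homomorphisms `φᵢ : Gᵢ → Hᵢ` of nontrivial finitely
generated groups onto nontrivial groups,
`p_c(G₁ * G₂) ≤ p_c(H₁ * H₂)`, where the Cayley graph of `H₁ * H₂` is taken w.r.t.
`φ₁(S₁) ⊔ φ₂(S₂)`. -/
theorem pc_free_product_quotient_le
    {G₁ G₂ H₁ H₂ : Type*} [Group G₁] [Group G₂] [Group H₁] [Group H₂]
    [Nontrivial G₁] [Nontrivial G₂] [Nontrivial H₁] [Nontrivial H₂]
    (S₁ : Set G₁) (S₂ : Set G₂) (hfin₁ : S₁.Finite) (hfin₂ : S₂.Finite)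
    (hgen₁ : Subgroup.closure S₁ = ⊤) (hgen₂ : Subgroup.closure S₂ = ⊤)
    (φ₁ : G₁ →* H₁) (φ₂ : G₂ →* H₂)
    (hφ₁ : Function.Surjective φ₁) (hφ₂ : Function.Surjective φ₂)
    (μ : ℝ → Measure (Config (Monoid.Coprod G₁ G₂ × (S₁ ⊕ S₂))))
    (μH : ℝ → Measure (Config (Monoid.Coprod H₁ H₂ × ((φ₁ '' S₁) ⊕ (φ₂ '' S₂)))))
    (hμ : ∀ p ∈ Set.Icc (0 : ℝ) 1, IsBernoulli p (μ p))
    (hμH : ∀ p ∈ Set.Icc (0 : ℝ) 1, IsBernoulli p (μH p)) :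
    pc (coprodGens S₁ S₂) μ ≤ pc (coprodGens (φ₁ '' S₁) (φ₂ '' S₂)) μH := by
  have := hfin₁.to_subtype
  have := hfin₂.to_subtype
  have := countable_of_closure_eq_top hfin₁.countable hgen₁
  have := countable_of_closure_eq_top hfin₂.countable hgen₂
  have := hφ₁.countable
  have := hφ₂.countable
  have := countable_coprod (G₁ := G₁) (G₂ := G₂)
  have := countable_coprod (G₁ := H₁) (G₂ := H₂)
  have hr₁ : ∀ k : φ₁ '' S₁, ∃ s : S₁, φ₁ s = k := fun ⟨_, s, hs, h⟩ => ⟨⟨s, hs⟩, h⟩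
  have hr₂ : ∀ k : φ₂ '' S₂, ∃ s : S₂, φ₂ s = k := fun ⟨_, s, hs, h⟩ => ⟨⟨s, hs⟩, h⟩
  choose r₁ hr₁ using hr₁
  choose r₂ hr₂ using hr₂
  refine pc_le_pc_of_quotient (φ := Monoid.Coprod.map φ₁ φ₂) (r := Sum.map r₁ r₂) ?_ ?_ hμ hμH
  · refine Function.Injective.sumMap (fun a b h => ?_) (fun a b h => ?_)
    · exact Subtype.ext (by rw [← hr₁ a, h, hr₁ b])
    · exact Subtype.ext (by rw [← hr₂ a, h, hr₂ b])
  · rintro (k | k)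
    · simp [coprodGens, hr₁]
    · simp [coprodGens, hr₂]
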